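/- arXiv:2405.05366 — 2 statements merged into one kernel-verified Lean document; each statement's English description precedes it below -/
import Mathlib

section
/- Let a > 0 and let φ : ℝ → ℝ be bounded, continuous on [0,∞), and possess a finite limit at +∞. Then for every ε > 0 there exists N such that for every natural number n ≥ N and every x ≥ 0 one has |n·a·∫_0^x e^{−n·a·(x−y)}·φ(y) dy + e^{−n·a·x}·φ(0) − φ(x)| ≤ ε. -/
open MeasureTheory Filter

lemma aux_int (k A C x : ℝ) (hk : 0 < k) :
    k * (∫ y in (0 : ℝ)..x, Real.exp (-k * (x - y)) * (A + C * (x - y)))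
      = A + C / k - Real.exp (-k * x) * (A + C * x + C / k) := by
  rw [← intervalIntegral.integral_const_mul]
  have h : ∀ y ∈ Set.uIcc 0 x, HasDerivAt
      (fun y => Real.exp (-k * (x - y)) * (A + C * (x - y) + C / k))
      (k * (Real.exp (-k * (x - y)) * (A + C * (x - y)))) y := by
    intro y _
    have h0 : HasDerivAt (fun y : ℝ => x - y) (-1) y := by
      simpa using (hasDerivAt_id y).const_sub x
    have h1 := (h0.const_mul (-k)).exp
    have h2 := ((h0.const_mul C).const_add A).add_const (C / k)
    refine (h1.mul h2).congr_deriv ?_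
    have h3 : C = k * (C / k) := by field_simp
    linear_combination (-Real.exp (-k * (x - y))) * h3
  rw [intervalIntegral.integral_eq_sub_of_hasDerivAt h]
  · simp
  · apply Continuous.intervalIntegrable
    fun_prop

lemma aux_upper (k B C x : ℝ) (hk : 0 < k) (hx : 0 ≤ x) (hC : 0 ≤ C) (φ : ℝ → ℝ)
    (hcont : ContinuousOn φ (Set.Ici 0))
    (hb : ∀ y, 0 ≤ y → y ≤ x → φ y ≤ B + C * (x - y)) :
    k * (∫ y in (0 : ℝ)..x, Real.exp (-k * (x - y)) * φ y)
        + Real.exp (-k * x) * φ 0 ≤ B + C / k := by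
  have h1 : (∫ y in (0 : ℝ)..x, Real.exp (-k * (x - y)) * φ y)
      ≤ ∫ y in (0 : ℝ)..x, Real.exp (-k * (x - y)) * (B + C * (x - y)) := by
    apply intervalIntegral.integral_mono_on hx
    · apply ContinuousOn.intervalIntegrable
      rw [Set.uIcc_of_le hx]
      apply ContinuousOn.mul
      · fun_prop
      · exact hcont.mono Set.Icc_subset_Ici_self
    · apply Continuous.intervalIntegrable
      fun_prop
    · intro y hy
      exact mul_le_mul_of_nonneg_left (hb y hy.1 hy.2) (Real.exp_pos _).le
  have h2 := mul_le_mul_of_nonneg_left h1 hk.le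
  rw [aux_int k B C x hk] at h2
  have h3 := mul_le_mul_of_nonneg_left (hb 0 le_rfl hx) (Real.exp_pos (-k * x)).le
  have h4 : 0 ≤ Real.exp (-k * x) * (C / k) := by positivity
  rw [sub_zero] at h3
  linarith

lemma aux_uc (φ : ℝ → ℝ) (hcont : ContinuousOn φ (Set.Ici 0))
    (L : ℝ) (hL : Tendsto φ atTop (nhds L)) (ε : ℝ) (hε : 0 < ε) :
    ∃ δ > 0, ∀ x y, 0 ≤ y → y ≤ x → x - y < δ → |φ y - φ x| ≤ ε := by
  obtain ⟨T, hT⟩ := Metric.tendsto_atTop.1 hL (ε / 2) (by positivity)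
  have hu := isCompact_Icc.uniformContinuousOn_of_continuous
    (hcont.mono (Set.Icc_subset_Ici_self : Set.Icc 0 (T + 1) ⊆ _))
  obtain ⟨δ, hδ, h⟩ := Metric.uniformContinuousOn_iff.1 hu ε hε
  refine ⟨min δ 1, by positivity, fun x y hy hyx hd => ?_⟩
  obtain ⟨hd1, hd2⟩ := lt_min_iff.1 hd
  by_cases hx : x ≤ T + 1
  · have := h y ⟨hy, hyx.trans hx⟩ x ⟨hy.trans hyx, hx⟩
      (by rw [Real.dist_eq, abs_sub_comm, abs_of_nonneg (by linarith)]; exact hd1)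
    exact this.le
  · have h1 := hT x (by linarith)
    have h2 := hT y (by linarith)
    have := dist_triangle_right (φ y) (φ x) L
    rw [← Real.dist_eq]
    linarith

theorem dirac_convolution_halfline_uniform
    (a : ℝ) (ha : 0 < a) (φ : ℝ → ℝ)
    (hbdd : ∃ M : ℝ, ∀ x : ℝ, |φ x| ≤ M)
    (hcont : ContinuousOn φ (Set.Ici 0))
    (hlim_top : ∃ L : ℝ, Tendsto φ atTop (nhds L)) :
    ∀ ε > 0, ∃ N : ℕ, ∀ n : ℕ, N ≤ n → ∀ x : ℝ, 0 ≤ x →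
      |(n : ℝ) * a * (∫ y in (0 : ℝ)..x, Real.exp (-((n : ℝ) * a) * (x - y)) * φ y)
        + Real.exp (-((n : ℝ) * a) * x) * φ 0 - φ x| ≤ ε := by
  intro ε hε
  obtain ⟨M, hM⟩ := hbdd
  obtain ⟨L, hL⟩ := hlim_top
  obtain ⟨δ, hδ, hd⟩ := aux_uc φ hcont L hL (ε / 2) (by positivity)
  have hM0 : 0 ≤ M := (abs_nonneg _).trans (hM 0)
  set C := 2 * M / δ with hCdef
  have hC : 0 ≤ C := by positivity
  have key : ∀ x y, 0 ≤ y → y ≤ x → |φ y - φ x| ≤ ε / 2 + C * (x - y) := by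
    intro x y hy hyx
    by_cases h : x - y < δ
    · have := hd x y hy hyx h
      have := mul_nonneg hC (sub_nonneg.2 hyx)
      linarith
    · have h1 : C * δ ≤ C * (x - y) := mul_le_mul_of_nonneg_left (not_lt.1 h) hC
      have h2 : C * δ = 2 * M := by rw [hCdef]; field_simp
      have := abs_sub (φ y) (φ x)
      have := hM x
      have := hM y
      linarith
  obtain ⟨N, hN⟩ := exists_nat_gt (2 * C / (ε * a))
  refine ⟨N, fun n hn x hx => ?_⟩
  have hn' : 2 * C / (ε * a) < n := hN.trans_le (by exact_mod_cast hn)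
  have hn0 : (0 : ℝ) < n := lt_of_le_of_lt (by positivity) hn'
  have hk : 0 < (n : ℝ) * a := by positivity
  have hCk : C / (n * a) ≤ ε / 2 := by
    rw [div_lt_iff₀ (by positivity)] at hn'
    rw [div_le_iff₀ hk]
    linarith
  have h1 := aux_upper (n * a) (φ x + ε / 2) C x hk hx hC φ hcont
    (fun y hy hyx => by have := (abs_le.1 (key x y hy hyx)).2; linarith)
  have h2 := aux_upper (n * a) (-φ x + ε / 2) C x hk hx hC (fun y => -φ y) hcont.neg
    (fun y hy hyx => by have := (abs_le.1 (key x y hy hyx)).1; linarith)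
  simp only [mul_neg, intervalIntegral.integral_neg] at h2
  rw [abs_le]
  constructor <;> linarith
end

section
/- Let α, β ≥ 0 with α + β > 0 and let f : ℝ → ℝ be bounded, continuous on ℝ∖{0}, with finite one-sided limits at 0 satisfying lim_{x→0+} f(x) = −lim_{x→0−} f(x), and with f(x) → L₊ as x → +∞ and f(x) → L₋ as x → −∞. Then for every x < 0 the Cesàro means (1/t)·∫_0^t C^weks[α,β](s)f(x) ds converge, as t → +∞, to (α·L₋ − β·L₊)/(α+β), and for every x > 0 they converge to (β·L₊ − α·L₋)/(α+β). -/
open MeasureTheory Filter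

/-- Left weks extension `Eℓ^weks[α,β]f`. -/
noncomputable def Elweks (α β : ℝ) (f : ℝ → ℝ) (x : ℝ) : ℝ :=
  if x < 0 then f x
  else ((α - β) / (α + β)) * f (-x) - (2 * β / (α + β)) * f x

/-- Right weks extension `Er^weks[α,β]f`. -/
noncomputable def Erweks (α β : ℝ) (f : ℝ → ℝ) (x : ℝ) : ℝ :=
  if x ≤ 0 then -(2 * α / (α + β)) * f x + ((β - α) / (α + β)) * f (-x)
  else f x

/-- Weks cosine family `C^weks[α,β](t)f(x)` (for `x ≠ 0`). -/
noncomputable def Cweks (α β : ℝ) (f : ℝ → ℝ) (t x : ℝ) : ℝ :=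
  if x < 0 then (1 / 2) * (Elweks α β f (x + t) + Elweks α β f (x - t))
  else (1 / 2) * (Erweks α β f (x + t) + Erweks α β f (x - t))


lemma cesaro_aux (g : ℝ → ℝ) (L M : ℝ) (hm : Measurable g) (hb : ∀ x, |g x| ≤ M)
    (hl : Tendsto g atTop (nhds L)) :
    Tendsto (fun t : ℝ => (1 / t) * ∫ s in (0 : ℝ)..t, g s) atTop (nhds L) := by
  have key : Tendsto (fun t : ℝ => ∫ u in (0 : ℝ)..1, g (t * u)) atTop
      (nhds (∫ u in (0 : ℝ)..1, L)) := by
    apply intervalIntegral.tendsto_integral_filter_of_dominated_convergence (fun _ => M)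
    · exact Eventually.of_forall fun t =>
        (hm.comp (measurable_const.mul measurable_id)).aestronglyMeasurable
    · exact Eventually.of_forall fun t => Eventually.of_forall fun u _ => hb _
    · simp
    · refine Eventually.of_forall fun u hu => ?_
      rw [Set.uIoc_of_le zero_le_one] at hu
      exact hl.comp (tendsto_id.atTop_mul_const hu.1)
  simp only [intervalIntegral.integral_const, sub_zero, one_smul] at key
  refine key.congr' ?_
  filter_upwards [eventually_gt_atTop 0] with t ht
  rw [intervalIntegral.integral_comp_mul_left _ ht.ne']
  simp

lemma cesaro_aux2 (E : ℝ → ℝ) (x A B M : ℝ) (hm : Measurable E) (hb : ∀ x, |E x| ≤ M)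
    (ht : Tendsto E atTop (nhds A)) (hbot : Tendsto E atBot (nhds B)) :
    Tendsto (fun t : ℝ => (1 / t) * ∫ s in (0 : ℝ)..t, (1 / 2) * (E (x + s) + E (x - s)))
      atTop (nhds ((1 / 2) * (A + B))) := by
  apply cesaro_aux _ _ M
  · have := hm.comp (measurable_const_add x)
    have := hm.comp (measurable_id.const_sub x)
    simp only [Function.comp_def, id] at *
    fun_prop
  · intro s
    have h1 := abs_le.1 (hb (x + s))
    have h2 := abs_le.1 (hb (x - s))
    rw [abs_le]
    constructor <;> linarith
  · refine ((ht.comp (tendsto_atTop_add_const_left _ x tendsto_id)).add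
      (hbot.comp ?_)).const_mul _
    exact (tendsto_atBot_add_const_left _ x tendsto_neg_atTop_atBot).congr fun s => (sub_eq_add_neg x s).symm

lemma lin_bound (a b u v M : ℝ) (hu : |u| ≤ M) (hv : |v| ≤ M) :
    |a * u + b * v| ≤ M + |a| * M + |b| * M := by
  have h0 : 0 ≤ M := (abs_nonneg u).trans hu
  have h1 := mul_le_mul_of_nonneg_left hu (abs_nonneg a)
  have h2 := mul_le_mul_of_nonneg_left hv (abs_nonneg b)
  have h3 := abs_add_le (a * u) (b * v)
  rw [abs_mul, abs_mul] at h3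
  linarith

lemma id_bound (a b u M : ℝ) (hu : |u| ≤ M) :
    |u| ≤ M + |a| * M + |b| * M := by
  have h0 : 0 ≤ M := (abs_nonneg u).trans hu
  have h1 := mul_nonneg (abs_nonneg a) h0
  have h2 := mul_nonneg (abs_nonneg b) h0
  linarith

theorem weks_cosine_cesaro_mean
    (α β : ℝ) (hα : 0 ≤ α) (hβ : 0 ≤ β) (hαβ : 0 < α + β)
    (f : ℝ → ℝ) (Lp Lm : ℝ)
    (hbdd : ∃ M : ℝ, ∀ x : ℝ, |f x| ≤ M)
    (hcont : ContinuousOn f {(0 : ℝ)}ᶜ)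
    (hlims0 : ∃ c : ℝ, Tendsto f (nhdsWithin 0 (Set.Ioi 0)) (nhds c) ∧
      Tendsto f (nhdsWithin 0 (Set.Iio 0)) (nhds (-c)))
    (hlim_top : Tendsto f atTop (nhds Lp))
    (hlim_bot : Tendsto f atBot (nhds Lm)) :
    (∀ x : ℝ, x < 0 →
      Tendsto (fun t : ℝ => (1 / t) * ∫ s in (0 : ℝ)..t, Cweks α β f s x)
        atTop (nhds ((α * Lm - β * Lp) / (α + β)))) ∧
    (∀ x : ℝ, 0 < x →
      Tendsto (fun t : ℝ => (1 / t) * ∫ s in (0 : ℝ)..t, Cweks α β f s x)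
        atTop (nhds ((β * Lp - α * Lm) / (α + β)))) := by
  obtain ⟨M, hM⟩ := hbdd
  have hf : Measurable f := measurable_of_continuousOn_compl_singleton 0 hcont
  have hfn : Measurable fun x => f (-x) := hf.comp measurable_neg
  have hnt : Tendsto (fun x => f (-x)) atTop (nhds Lm) := hlim_bot.comp tendsto_neg_atTop_atBot
  have hnb : Tendsto (fun x => f (-x)) atBot (nhds Lp) := hlim_top.comp tendsto_neg_atBot_atTop
  constructor
  · intro x hx
    have h := cesaro_aux2 (Elweks α β f) x
      (((α - β) / (α + β)) * Lm - (2 * β / (α + β)) * Lp) Lm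
      (M + |(α - β) / (α + β)| * M + |-(2 * β / (α + β))| * M) ?_ ?_ ?_ ?_
    · simp only [Cweks, if_pos hx]
      convert h using 2
      field_simp
      ring
    · unfold Elweks
      exact Measurable.ite measurableSet_Iio hf ((hfn.const_mul _).sub (hf.const_mul _))
    · intro y
      unfold Elweks
      split_ifs
      · exact id_bound _ _ _ _ (hM _)
      · rw [sub_eq_add_neg, ← neg_mul]
        exact lin_bound _ _ _ _ _ (hM _) (hM _)
    · refine ((hnt.const_mul _).sub (hlim_top.const_mul _)).congr' ?_
      filter_upwards [eventually_gt_atTop 0] with t ht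
      simp [Elweks, not_lt.2 ht.le]
    · refine hlim_bot.congr' ?_
      filter_upwards [eventually_lt_atBot 0] with t ht
      simp [Elweks, ht]
  · intro x hx
    have h := cesaro_aux2 (Erweks α β f) x Lp
      (-(2 * α / (α + β)) * Lm + ((β - α) / (α + β)) * Lp)
      (M + |-(2 * α / (α + β))| * M + |(β - α) / (α + β)| * M) ?_ ?_ ?_ ?_
    · simp only [Cweks, if_neg (not_lt.2 hx.le)]
      convert h using 2
      field_simp
      ring
    · unfold Erweks
      exact Measurable.ite measurableSet_Iic ((hf.const_mul _).add (hfn.const_mul _)) hf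
    · intro y
      unfold Erweks
      split_ifs
      · exact lin_bound _ _ _ _ _ (hM _) (hM _)
      · exact id_bound _ _ _ _ (hM _)
    · refine hlim_top.congr' ?_
      filter_upwards [eventually_gt_atTop 0] with t ht
      simp [Erweks, not_le.2 ht]
    · refine ((hlim_bot.const_mul _).add (hnb.const_mul _)).congr' ?_
      filter_upwards [eventually_lt_atBot 0] with t ht
      simp [Erweks, ht.le]
end
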